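/- arXiv:1512.05411 — 5 statements merged into one kernel-verified Lean document; each statement's English description precedes it below -/
import Mathlib

section
/- There exists a constant c > 0 such that for every n ≥ 6 the following holds. Suppose that for each vertex v ∈ Fin n we are given a probe decision tree T_v over Fin n of depth at most t, and suppose that for every valid two-path instance G on vertex set Fin n, the family of outputs v ↦ eval(T_v, G) equals true on exactly one vertex, and that vertex is the middle vertex of one of the two paths of G. Then t ≥ c · n. -/
/-- A probe decision tree over `Fin n`: either a leaf carrying an output bit, or a probe node
carrying a vertex `v` together with a continuation assigning a subtree to each possible
answer (each finite subset of `Fin n`, the neighbourhood of `v`). -/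
inductive ProbeTree (n : ℕ) : Type
  | leaf : Bool → ProbeTree n
  | probe : Fin n → (Finset (Fin n) → ProbeTree n) → ProbeTree n

namespace ProbeTree

/-- The depth of a probe decision tree: the maximum number of probe nodes on any
root-to-leaf path. -/
def depth {n : ℕ} : ProbeTree n → ℕ
  | leaf _ => 0
  | probe _ f => 1 + Finset.univ.sup fun s => (f s).depth

/-- Evaluate a probe decision tree on a graph given by its neighbourhood function `nbr`:
at each probe node with vertex `v`, follow the child indexed by `nbr v`, until a leaf
is reached. -/
def eval {n : ℕ} : ProbeTree n → (Fin n → Finset (Fin n)) → Bool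
  | leaf b, _ => b
  | probe v f, nbr => (f (nbr v)).eval nbr

end ProbeTree

/-- The neighbourhood function of the graph with (Boolean) adjacency matrix `A`. -/
def nbhd {n : ℕ} (A : Fin n → Fin n → Bool) (v : Fin n) : Finset (Fin n) :=
  Finset.univ.filter fun u => A v u

/-- `A` is a valid two-path instance with paths `a₁‑a₂‑a₃` and `b₁‑b₂‑b₃`: the six vertices are
distinct and the edge set of the graph with adjacency matrix `A` is exactly
`{a₁a₂, a₂a₃, b₁b₂, b₂b₃}` (all other vertices isolated). -/
def IsTwoPath {n : ℕ} (A : Fin n → Fin n → Bool) (a₁ a₂ a₃ b₁ b₂ b₃ : Fin n) : Prop :=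
  ([a₁, a₂, a₃, b₁, b₂, b₃] : List (Fin n)).Nodup ∧
    ∀ u v : Fin n, A u v = true ↔
      ({u, v} : Finset (Fin n)) ∈
        ({{a₁, a₂}, {a₂, a₃}, {b₁, b₂}, {b₂, b₃}} : Finset (Finset (Fin n)))

namespace ProbeTree

/-- The set of vertices probed when the tree is evaluated on `nbr`. -/
def probed {n : ℕ} : ProbeTree n → (Fin n → Finset (Fin n)) → Finset (Fin n)
  | leaf _, _ => ∅
  | probe v f, nbr => insert v ((f (nbr v)).probed nbr)

theorem card_probed_le_depth {n : ℕ} (T : ProbeTree n) (nbr : Fin n → Finset (Fin n)) :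
    (T.probed nbr).card ≤ T.depth := by
  induction T with
  | leaf b => simp [probed]
  | probe v f ih =>
    have hle : (f (nbr v)).depth ≤ Finset.univ.sup fun s => (f s).depth :=
      Finset.le_sup (f := fun s => (f s).depth) (Finset.mem_univ (nbr v))
    have hins := Finset.card_insert_le v ((f (nbr v)).probed nbr)
    have := ih (nbr v)
    simp only [probed, depth]
    omega

theorem eval_congr_of_probed {n : ℕ} (T : ProbeTree n) {nbr nbr' : Fin n → Finset (Fin n)}
    (h : ∀ v ∈ T.probed nbr, nbr' v = nbr v) : T.eval nbr' = T.eval nbr := by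
  induction T with
  | leaf b => rfl
  | probe v f ih =>
    simp only [probed, Finset.mem_insert, forall_eq_or_imp] at h
    simp only [eval, h.1]
    exact ih _ h.2

theorem eval_eq_of_depth_eq_zero {n : ℕ} {T : ProbeTree n} (h : T.depth = 0)
    (nbr nbr' : Fin n → Finset (Fin n)) : T.eval nbr' = T.eval nbr := by
  refine eval_congr_of_probed T fun v hv => ?_
  have := Finset.card_pos.2 ⟨v, hv⟩
  have := T.card_probed_le_depth nbr
  omega

end ProbeTree

/-- The adjacency matrix of the graph with edge set `E`. -/
def edgeAdj {n : ℕ} (E : Finset (Finset (Fin n))) (u v : Fin n) : Bool :=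
  decide ({u, v} ∈ E)

theorem isTwoPath_edgeAdj {n : ℕ} {a₁ a₂ a₃ b₁ b₂ b₃ : Fin n}
    (h : ([a₁, a₂, a₃, b₁, b₂, b₃] : List (Fin n)).Nodup) :
    IsTwoPath (edgeAdj {{a₁, a₂}, {a₂, a₃}, {b₁, b₂}, {b₂, b₃}}) a₁ a₂ a₃ b₁ b₂ b₃ :=
  ⟨h, fun _ _ => by simp only [edgeAdj, decide_eq_true_eq]⟩

theorem nbhd_edgeAdj_congr {n : ℕ} {E F : Finset (Finset (Fin n))} {v : Fin n}
    (h : ∀ e, v ∈ e → (e ∈ E ↔ e ∈ F)) : nbhd (edgeAdj E) v = nbhd (edgeAdj F) v := by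
  ext u
  simp [nbhd, edgeAdj, h {v, u} (by simp)]

/-- If each `f i` has at most `t` elements, then some `i ∈ s` is unrelated, in both directions, to
all but `2 * t + 1` elements of `s`. -/
theorem exists_large_unrelated {ι : Type*} [DecidableEq ι] {s : Finset ι} (hs : s.Nonempty)
    {f : ι → Finset ι} {t : ℕ} (hf : ∀ i, (f i).card ≤ t) :
    ∃ i ∈ s, ∃ u ⊆ s, s.card ≤ u.card + (2 * t + 1) ∧
      ∀ j ∈ u, i ≠ j ∧ j ∉ f i ∧ i ∉ f j := by
  obtain ⟨i, hi, hit⟩ : ∃ i ∈ s, (s.filter fun j => i ∈ f j).card ≤ t := by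
    by_contra! h
    have hcount : ∑ i ∈ s, (s.filter fun j => i ∈ f j).card
        = ∑ j ∈ s, (s.filter fun i => i ∈ f j).card :=
      Finset.sum_card_bipartiteAbove_eq_sum_card_bipartiteBelow fun i j => i ∈ f j
    have hlt := Finset.sum_lt_sum_of_nonempty hs h
    have hle : ∑ j ∈ s, (s.filter fun i => i ∈ f j).card ≤ ∑ _j ∈ s, t :=
      Finset.sum_le_sum fun j _ => (Finset.card_le_card fun i hi =>
        (Finset.mem_filter.1 hi).2).trans (hf j)
    omega
  refine ⟨i, hi, s \ insert i (f i ∪ s.filter fun j => i ∈ f j), Finset.sdiff_subset, ?_, ?_⟩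
  · have h₁ := Finset.le_card_sdiff (insert i (f i ∪ s.filter fun j => i ∈ f j)) s
    have h₂ := Finset.card_insert_le i (f i ∪ s.filter fun j => i ∈ f j)
    have h₃ := Finset.card_union_le (f i) (s.filter fun j => i ∈ f j)
    have := hf i
    omega
  · intro j hj
    simp only [Finset.mem_sdiff, Finset.mem_insert, Finset.mem_union, Finset.mem_filter] at hj
    grind

theorem exists_pairwise_unrelated_triple {ι : Type*} [DecidableEq ι] {s : Finset ι}
    {f : ι → Finset ι} {t : ℕ} (hf : ∀ i, (f i).card ≤ t) (hs : 4 * t + 3 ≤ s.card) :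
    ∃ i ∈ s, ∃ j ∈ s, ∃ k ∈ s, (i ≠ j ∧ j ∉ f i ∧ i ∉ f j) ∧ (i ≠ k ∧ k ∉ f i ∧ i ∉ f k) ∧
      (j ≠ k ∧ k ∉ f j ∧ j ∉ f k) := by
  obtain ⟨i, hi, u, hu, hcard, hiu⟩ :=
    exists_large_unrelated (s := s) (Finset.card_pos.1 (by omega)) hf
  obtain ⟨j, hj, w, hw, hcard', hjw⟩ :=
    exists_large_unrelated (s := u) (Finset.card_pos.1 (by omega)) hf
  obtain ⟨k, hk⟩ : w.Nonempty := Finset.card_pos.1 (by omega)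
  exact ⟨i, hi, j, hu hj, k, hu (hw hk), hiu j hj, hiu k (hw hk), hjw k hk⟩

/-- The family `T` elects exactly one of the two middle vertices on every two-path instance. -/
def ElectsMiddle {n : ℕ} (T : Fin n → ProbeTree n) : Prop :=
  ∀ (A : Fin n → Fin n → Bool) (a₁ a₂ a₃ b₁ b₂ b₃ : Fin n), IsTwoPath A a₁ a₂ a₃ b₁ b₂ b₃ →
    (∀ v : Fin n, (T v).eval (nbhd A) = true ↔ v = a₂) ∨
    (∀ v : Fin n, (T v).eval (nbhd A) = true ↔ v = b₂)

/-- The neighbourhood function of the graph whose only edges are those of a single path. -/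
def pathNbhd {n : ℕ} (a₁ a₂ a₃ : Fin n) : Fin n → Finset (Fin n) :=
  nbhd (edgeAdj {{a₁, a₂}, {a₂, a₃}})

/-- If neither middle vertex, seeing only its own path, probes the other path, then the two middle
vertices output different bits on their own paths. -/
theorem ElectsMiddle.eval_pathNbhd_ne {n : ℕ} {T : Fin n → ProbeTree n} (hT : ElectsMiddle T)
    {a₁ a₂ a₃ b₁ b₂ b₃ : Fin n} (hnd : ([a₁, a₂, a₃, b₁, b₂, b₃] : List (Fin n)).Nodup)
    (ha : ∀ v ∈ (T a₂).probed (pathNbhd a₁ a₂ a₃), v ≠ b₁ ∧ v ≠ b₂ ∧ v ≠ b₃)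
    (hb : ∀ v ∈ (T b₂).probed (pathNbhd b₁ b₂ b₃), v ≠ a₁ ∧ v ≠ a₂ ∧ v ≠ a₃) :
    (T a₂).eval (pathNbhd a₁ a₂ a₃) ≠ (T b₂).eval (pathNbhd b₁ b₂ b₃) := by
  have hab : a₂ ≠ b₂ := by
    rintro rfl
    simp at hnd
  let E : Finset (Finset (Fin n)) := {{a₁, a₂}, {a₂, a₃}, {b₁, b₂}, {b₂, b₃}}
  have hEa : (T a₂).eval (nbhd (edgeAdj E)) = (T a₂).eval (pathNbhd a₁ a₂ a₃) :=
    ProbeTree.eval_congr_of_probed _ fun v hv => nbhd_edgeAdj_congr fun e he => by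
      have := ha v hv
      grind
  have hEb : (T b₂).eval (nbhd (edgeAdj E)) = (T b₂).eval (pathNbhd b₁ b₂ b₃) :=
    ProbeTree.eval_congr_of_probed _ fun v hv => nbhd_edgeAdj_congr fun e he => by
      have := hb v hv
      grind
  rw [← hEa, ← hEb]
  intro heq
  rcases hT _ a₁ a₂ a₃ b₁ b₂ b₃ (isTwoPath_edgeAdj hnd) with h | h
  · exact hab ((h b₂).1 (heq ▸ (h a₂).2 rfl)).symm
  · exact hab ((h a₂).1 (heq ▸ (h b₂).2 rfl))

theorem ElectsMiddle.exists_depth_pos {n : ℕ} (hn : 6 ≤ n) {T : Fin n → ProbeTree n}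
    (hT : ElectsMiddle T) : ∃ v, 0 < (T v).depth := by
  by_contra! h
  let x : Fin 6 → Fin n := Fin.castLE hn
  have hx : Function.Injective x := Fin.castLE_injective hn
  have hnd : ([x 0, x 1, x 2, x 3, x 4, x 5] : List (Fin n)).Nodup :=
    List.Nodup.map hx (l := [0, 1, 2, 3, 4, 5]) (by decide)
  have hnd' : ([x 1, x 0, x 2, x 4, x 3, x 5] : List (Fin n)).Nodup :=
    List.Nodup.map hx (l := [1, 0, 2, 4, 3, 5]) (by decide)
  have hconst (v : Fin n) (nbr nbr' : Fin n → Finset (Fin n)) :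
      (T v).eval nbr' = (T v).eval nbr :=
    ProbeTree.eval_eq_of_depth_eq_zero (Nat.le_zero.1 (h v)) _ _
  have key (a b : Fin 6) {A B : Fin n → Fin n → Bool} (hab : a ≠ b)
      (ha : ∀ v, (T v).eval (nbhd A) = true ↔ v = x a)
      (hb : ∀ v, (T v).eval (nbhd B) = true ↔ v = x b) : False :=
    hab (hx ((hb _).1 (hconst _ (nbhd A) (nbhd B) ▸ (ha _).2 rfl)))
  rcases hT _ _ _ _ _ _ _ (isTwoPath_edgeAdj hnd) with h₁ | h₁ <;>
    rcases hT _ _ _ _ _ _ _ (isTwoPath_edgeAdj hnd') with h₂ | h₂ <;>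
    exact key _ _ (by decide) h₁ h₂

theorem ElectsMiddle.lt_of_depth_le {n : ℕ} [NeZero n] {T : Fin n → ProbeTree n}
    (hT : ElectsMiddle T) {t : ℕ} (ht : ∀ v, (T v).depth ≤ t) : n < 12 * t + 9 := by
  by_contra! hn
  let p (i k : ℕ) : Fin n := Fin.ofNat n (3 * i + k)
  let S (i : ℕ) : Finset (Fin n) := (T (p i 1)).probed (pathNbhd (p i 0) (p i 1) (p i 2))
  let f (i : ℕ) : Finset ℕ := (S i).image fun v => v.val / 3
  have hf (i : ℕ) : (f i).card ≤ t :=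
    Finset.card_image_le.trans (((T (p i 1)).card_probed_le_depth _).trans (ht _))
  have hp {i k : ℕ} (hi : i ∈ Finset.range (4 * t + 3)) (hk : k < 3) :
      (p i k).val = 3 * i + k := by
    have := Finset.mem_range.1 hi
    exact Nat.mod_eq_of_lt (by omega)
  have hne {i j k l : ℕ} (hi : i ∈ Finset.range (4 * t + 3)) (hj : j ∈ Finset.range (4 * t + 3))
      (hk : k < 3) (hl : l < 3) (h : i ≠ j ∨ k ≠ l) : p i k ≠ p j l := by
    intro heq
    have := congrArg Fin.val heq
    rw [hp hi hk, hp hj hl] at this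
    omega
  have hS {i j k : ℕ} (hj : j ∈ Finset.range (4 * t + 3)) (hk : k < 3) (hij : j ∉ f i)
      {v : Fin n} (hv : v ∈ S i) : v ≠ p j k := by
    rintro rfl
    refine hij (Finset.mem_image.2 ⟨_, hv, ?_⟩)
    simp only [hp hj hk]
    omega
  let o (i : ℕ) : Bool := (T (p i 1)).eval (pathNbhd (p i 0) (p i 1) (p i 2))
  have ho {i j : ℕ} (hi : i ∈ Finset.range (4 * t + 3)) (hj : j ∈ Finset.range (4 * t + 3))
      (h : i ≠ j ∧ j ∉ f i ∧ i ∉ f j) : o i ≠ o j := by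
    obtain ⟨hij, hfi, hfj⟩ := h
    refine hT.eval_pathNbhd_ne ?_ (fun v hv => ?_) (fun v hv => ?_)
    · simp [hne hi hi, hne hi hj, hne hj hj, hij]
    · exact ⟨hS hj (by omega) hfi hv, hS hj (by omega) hfi hv, hS hj (by omega) hfi hv⟩
    · exact ⟨hS hi (by omega) hfj hv, hS hi (by omega) hfj hv, hS hi (by omega) hfj hv⟩
  obtain ⟨i, hi, j, hj, k, hk, hij, hik, hjk⟩ :=
    exists_pairwise_unrelated_triple (s := Finset.range (4 * t + 3)) hf (by simp)
  have h₁ := ho hi hj hij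
  have h₂ := ho hi hk hik
  have h₃ := ho hj hk hjk
  cases h : o i <;> simp_all

/-- Theorem of Section 5.3: every deterministic stateless LCA algorithm (i.e. family of parallel
probe decision trees) solving the two-path leader-election problem — on every valid two-path
instance exactly one vertex outputs `true`, and it is a middle vertex — requires `Ω(n)`
probes. -/
theorem twoPath_leader_election_lower_bound :
    ∃ c : ℝ, 0 < c ∧
      ∀ n : ℕ, 6 ≤ n → ∀ t : ℕ, ∀ T : Fin n → ProbeTree n,
        (∀ v : Fin n, (T v).depth ≤ t) →
        (∀ (A : Fin n → Fin n → Bool) (a₁ a₂ a₃ b₁ b₂ b₃ : Fin n),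
          IsTwoPath A a₁ a₂ a₃ b₁ b₂ b₃ →
            (∀ v : Fin n, (T v).eval (nbhd A) = true ↔ v = a₂) ∨
            (∀ v : Fin n, (T v).eval (nbhd A) = true ↔ v = b₂)) →
        c * n ≤ t := by
  refine ⟨1 / 21, by norm_num, fun n hn t T ht hT => ?_⟩
  have : NeZero n := ⟨by omega⟩
  have hT : ElectsMiddle T := hT
  obtain ⟨v, hv⟩ := hT.exists_depth_pos hn
  have hlt := hT.lt_of_depth_le ht
  have hle : n ≤ 21 * t := by
    have := ht v
    omega
  have : (n : ℝ) ≤ 21 * t := by exact_mod_cast hle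
  linarith
end

section
/- Let N, N' be natural numbers with N' > 0, let R : Fin N → Fin N → Prop be a decidable relation (the legal pairs) such that for every row i the number of columns j with R i j equals N', and let M : Fin N → Fin N → Bool. Assume the number of legal pairs (i,j) with M i j = true equals the number of legal pairs with M i j = false. For each row i let o(i) be the number of columns j with R i j and M i j = true, and assume that for every row i either 3·o(i) < N' or 3·o(i) > 2·N'. Let L₁ = {i : 3·o(i) > 2·N'} and L₀ = {i : 3·o(i) < N'}. Then 4·|L₀| ≥ N and 4·|L₁| ≥ N. -/
open Finset

/-- If `f` is bounded by `n > 0`, has average `n / 2`, and is at most `n / 3` wherever `p` fails,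
then `p` holds on at least a quarter of the index type. -/
theorem card_le_four_mul_card_filter {ι : Type*} [Fintype ι] {n : ℕ} (hn : 0 < n)
    (f : ι → ℕ) (p : ι → Prop) [DecidablePred p] (hle : ∀ i, f i ≤ n)
    (hsmall : ∀ i, ¬ p i → 3 * f i ≤ n) (hsum : 2 * ∑ i, f i = Fintype.card ι * n) :
    Fintype.card ι ≤ 4 * (univ.filter p).card := by
  have hbound : ∑ i, 3 * f i ≤ ∑ i, (n + if p i then 2 * n else 0) := by
    refine sum_le_sum fun i _ => ?_
    split_ifs with h
    · linarith [hle i]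
    · exact hsmall i h
  rw [← mul_sum, sum_add_distrib, sum_const, ← sum_filter, sum_const, card_univ, smul_eq_mul,
    smul_eq_mul] at hbound
  refine Nat.le_of_mul_le_mul_right ?_ hn
  linarith

/-- The number of pairs satisfying `P` is the sum over the rows of the row counts. -/
theorem card_filter_prod_eq_sum {α β : Type*} [Fintype α] [Fintype β] (P : α → β → Prop)
    [∀ a, DecidablePred (P a)] :
    (univ.filter fun q : α × β => P q.1 q.2).card = ∑ a, (univ.filter (P a)).card := by
  simp only [card_filter, Fintype.sum_prod_type]

/-- Lemma of Section 5.3: if no row has a number of 1's in `[N'/3, 2N'/3]` (i.e. `S = ∅`),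
then both `L₀` and `L₁` contain at least `N/4` rows. -/
theorem L0_L1_large (N N' : ℕ) (hN' : 0 < N')
    (R : Fin N → Fin N → Prop) [DecidableRel R]
    (hrow : ∀ i : Fin N, (univ.filter fun j => R i j).card = N')
    (M : Fin N → Fin N → Bool)
    (hbal : (univ.filter fun p : Fin N × Fin N => R p.1 p.2 ∧ M p.1 p.2 = true).card =
            (univ.filter fun p : Fin N × Fin N => R p.1 p.2 ∧ M p.1 p.2 = false).card)
    (o : Fin N → ℕ)
    (ho : ∀ i : Fin N, o i = (univ.filter fun j => R i j ∧ M i j = true).card)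
    (hS : ∀ i : Fin N, 3 * o i < N' ∨ 3 * o i > 2 * N') :
    4 * (univ.filter fun i : Fin N => 3 * o i < N').card ≥ N ∧
    4 * (univ.filter fun i : Fin N => 3 * o i > 2 * N').card ≥ N := by
  have hsplit (i : Fin N) : o i + (univ.filter fun j => R i j ∧ M i j = false).card = N' := by
    rw [ho, ← hrow i, ← card_filter_add_card_filter_not (s := univ.filter (R i))
      (fun j => M i j = true)]
    simp only [filter_filter, Bool.not_eq_true]
  rw [card_filter_prod_eq_sum (fun i j => R i j ∧ M i j = true),
    card_filter_prod_eq_sum (fun i j => R i j ∧ M i j = false)] at hbal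
  simp only [← ho] at hbal
  have htotal := Fintype.sum_congr _ _ hsplit
  rw [sum_add_distrib, sum_const, card_univ, smul_eq_mul] at htotal
  constructor
  · simpa only [Fintype.card_fin] using card_le_four_mul_card_filter hN'
      (fun i => (univ.filter fun j => R i j ∧ M i j = false).card) (fun i => 3 * o i < N')
      (fun i => by have := hsplit i; omega)
      (fun i hi => by have := hsplit i; have := hS i; omega) (by omega)
  · simpa only [Fintype.card_fin] using card_le_four_mul_card_filter hN' o
      (fun i => 3 * o i > 2 * N') (fun i => by have := hsplit i; omega)
      (fun i hi => by have := hS i; omega) (by omega)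
end

section
/- Let N, N' be natural numbers with N' ≤ N, let R : Fin N → Fin N → Prop be a decidable relation, M : Fin N → Fin N → Bool, and let L be a finite set of rows (L ⊆ Fin N) such that for every i ∈ L the number of columns j with R i j and M i j = true, multiplied by 3, is at least 2·N'. Then for every real number c ≥ 0 with 3·N·N'·c < |L|·(4·N' − 3·N), the number of columns j ∈ Fin N for which |{i ∈ L : R i j and M i j = true}| > c·N' is strictly greater than N/2. -/
open Finset

/-- If `f ≤ b` on `s`, splitting `∑ f` at the threshold `t` bounds it by `b` on the elements
above `t` and by `t` on the others. -/
theorem sum_le_card_filter_lt_mul_add {ι : Type*} (s : Finset ι) (f : ι → ℝ) (t b : ℝ)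
    (hb : ∀ j ∈ s, f j ≤ b) :
    ∑ j ∈ s, f j ≤
      (#{j ∈ s | t < f j} : ℝ) * b + ((#s : ℝ) - (#{j ∈ s | t < f j} : ℝ)) * t := by
  rw [← sum_filter_add_sum_filter_not s (fun j => t < f j)]
  have hcard : (#{j ∈ s | t < f j} : ℝ) + (#{j ∈ s | ¬ t < f j} : ℝ) = #s := by
    exact_mod_cast card_filter_add_card_filter_not (s := s) (fun j => t < f j)
  rw [← hcard, add_sub_cancel_left, ← nsmul_eq_mul, ← nsmul_eq_mul]
  exact add_le_add
    (sum_le_card_nsmul _ _ _ fun j hj => hb j (mem_filter.1 hj).1)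
    (sum_le_card_nsmul _ _ _ fun j hj => not_lt.1 (mem_filter.1 hj).2)

/-- Averaging step in the proof of the two-path leader-election lower bound (Section 5.3):
if every row of `L` has at least `(2/3)·N'` ones among legal columns, then strictly more than
half of the columns each contain more than `c·N'` ones restricted to `L`. -/
theorem majority_of_columns_heavy (N N' : ℕ) (hN' : N' ≤ N)
    (R : Fin N → Fin N → Prop) [DecidableRel R]
    (M : Fin N → Fin N → Bool)
    (L : Finset (Fin N))
    (hL : ∀ i ∈ L, 3 * (univ.filter fun j => R i j ∧ M i j = true).card ≥ 2 * N') :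
    ∀ c : ℝ, 0 ≤ c →
      3 * (N : ℝ) * N' * c < (L.card : ℝ) * (4 * (N' : ℝ) - 3 * N) →
      ((univ.filter fun j : Fin N =>
          ((L.filter fun i => R i j ∧ M i j = true).card : ℝ) > c * N').card : ℝ) > N / 2 := by
  intro c hc h
  by_contra! hheavy
  have hrows : #L * (2 * N') ≤ 3 * ∑ j, #{i ∈ L | R i j ∧ M i j = true} := by
    have hcomm : ∑ i ∈ L, #{j | R i j ∧ M i j = true} = ∑ j, #{i ∈ L | R i j ∧ M i j = true} :=
      sum_card_bipartiteAbove_eq_sum_card_bipartiteBelow (fun i j => R i j ∧ M i j = true)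
    rw [← hcomm, mul_sum, ← smul_eq_mul]
    exact card_nsmul_le_sum _ _ _ hL
  have hrows' : (#L : ℝ) * (2 * N') ≤ 3 * ∑ j, (#{i ∈ L | R i j ∧ M i j = true} : ℝ) := by
    exact_mod_cast hrows
  have hcols := sum_le_card_filter_lt_mul_add univ
    (fun j => (#{i ∈ L | R i j ∧ M i j = true} : ℝ)) (c * N') #L
    fun j _ => by exact_mod_cast card_filter_le _ _
  rw [card_univ, Fintype.card_fin] at hcols
  have hN : (N' : ℝ) ≤ N := by exact_mod_cast hN'
  have hcN' : 0 ≤ c * N' := by positivity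
  have hthreshold : c * N' ≤ #L := by
    by_contra! hlt
    have hL0 : (0 : ℝ) ≤ #L := by positivity
    have hN0 : (0 : ℝ) ≤ N := by positivity
    nlinarith [mul_le_mul_of_nonneg_left hN hL0, mul_le_mul_of_nonneg_left hlt.le hN0,
      mul_nonneg hN0 hcN']
  have hmono := mul_le_mul_of_nonneg_right hheavy (sub_nonneg.2 hthreshold)
  simp only [gt_iff_lt] at hmono
  linarith
end

section
/- Let N, N' be natural numbers with N' > 0, N' ≤ N and 4·N' > 3·N, let R : Fin N → Fin N → Prop be a decidable relation such that every row has exactly N' legal columns, and let M : Fin N → Fin N → Bool be such that the number of legal pairs with value true equals the number of legal pairs with value false. For each row i let o(i) = |{j : R i j and M i j = true}|, assume for every row i either 3·o(i) < N' or 3·o(i) > 2·N', and set L₁ = {i : 3·o(i) > 2·N'}, L₀ = {i : 3·o(i) < N'}. Then for every real number c ≥ 0 with 12·N'·c < 4·N' − 3·N, there exists a column j ∈ Fin N such that |{i ∈ L₁ : R i j and M i j = true}| > c·N' and |{i ∈ L₀ : R i j and M i j = false}| > c·N'. -/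
open Finset

/-- If a weight function bounded by `m` has average `m / 2` and is at most `m / 3` outside `L`,
then `L` contains at least a quarter of all indices. -/
lemma card_le_four_mul_card_of_sum_eq {ι : Type*} [Fintype ι] [DecidableEq ι] {m : ℕ}
    (hm : 0 < m) (f : ι → ℕ) (L : Finset ι) (hle : ∀ i, f i ≤ m) (hL : ∀ i ∉ L, 3 * f i ≤ m)
    (hsum : 2 * ∑ i, f i = Fintype.card ι * m) : Fintype.card ι ≤ 4 * L.card := by
  have h₁ : ∑ i ∈ L, f i ≤ L.card * m := by
    simpa using sum_le_card_nsmul L f m fun i _ => hle i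
  have h₂ : 3 * ∑ i ∈ Lᶜ, f i ≤ Lᶜ.card * m := by
    rw [mul_sum]
    simpa using sum_le_card_nsmul Lᶜ (fun i => 3 * f i) m fun i hi => hL i (by simpa using hi)
  have h₃ := sum_add_sum_compl L f
  have h₄ := card_add_card_compl L
  rw [← h₄] at hsum ⊢
  nlinarith

/-- If every row of `S` has at least `k` entries and every column outside `X` has at most `t`
entries in the rows of `S`, then double counting bounds `k` whenever `S` is large. -/
lemma card_mul_sub_le_of_forall_le {ι κ : Type*} [Fintype ι] [Fintype κ] [DecidableEq κ]
    (P : ι → κ → Prop) [∀ i, DecidablePred (P i)] (S : Finset ι) (X : Finset κ) {k t s : ℝ}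
    (ht : 0 ≤ t) (hs : 0 ≤ s) (hsS : s ≤ S.card)
    (hrow : ∀ i ∈ S, k ≤ (univ.filter fun j => P i j).card)
    (hcol : ∀ j ∉ X, ((S.filter fun i => P i j).card : ℝ) ≤ t) :
    s * (k - X.card) ≤ Xᶜ.card * t := by
  have hcount : ∑ i ∈ S, ((univ.filter fun j => P i j).card : ℝ) =
      ∑ j, ((S.filter fun i => P i j).card : ℝ) := by
    exact_mod_cast sum_card_bipartiteAbove_eq_sum_card_bipartiteBelow (s := S) (t := univ) P
  have h₁ : S.card * k ≤ ∑ i ∈ S, ((univ.filter fun j => P i j).card : ℝ) := by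
    simpa using card_nsmul_le_sum S _ k hrow
  have h₂ : ∑ j ∈ X, ((S.filter fun i => P i j).card : ℝ) ≤ X.card * S.card := by
    simpa using sum_le_card_nsmul X (fun j => ((S.filter fun i => P i j).card : ℝ)) S.card
      fun j _ => by exact_mod_cast card_filter_le _ _
  have h₃ : ∑ j ∈ Xᶜ, ((S.filter fun i => P i j).card : ℝ) ≤ Xᶜ.card * t := by
    simpa using sum_le_card_nsmul Xᶜ (fun j => ((S.filter fun i => P i j).card : ℝ)) t
      fun j hj => hcol j (by simpa using hj)
  rw [hcount, ← sum_add_sum_compl X] at h₁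
  rcases le_total 0 (k - X.card) with h | h
  · nlinarith [mul_le_mul_of_nonneg_right hsS h]
  · exact (mul_nonpos_of_nonneg_of_nonpos hs h).trans (by positivity)

/-- The number of pairs satisfying a relation is the sum of its row counts. -/
lemma card_filter_prod_eq_sum_s3 {ι κ : Type*} [Fintype ι] [Fintype κ] (P : ι → κ → Prop)
    [∀ i, DecidablePred (P i)] [DecidablePred fun p : ι × κ => P p.1 p.2] :
    (univ.filter fun p : ι × κ => P p.1 p.2).card = ∑ i, (univ.filter fun j => P i j).card := by
  simp only [card_filter, Fintype.sum_prod_type]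
  congr!

/-- Combined conclusion of the first part of the proof of the two-path leader-election lower
bound (Section 5.3): there is a column on which both answers 1 and 0 occur more than `c·N'`
times among the respective row classes `L₁` and `L₀`. -/
theorem exists_balanced_column (N N' : ℕ) (hN'pos : 0 < N') (hN' : N' ≤ N)
    (hN'N : 4 * N' > 3 * N)
    (R : Fin N → Fin N → Prop) [DecidableRel R]
    (hrow : ∀ i : Fin N, (univ.filter fun j => R i j).card = N')
    (M : Fin N → Fin N → Bool)
    (hbal : (univ.filter fun p : Fin N × Fin N => R p.1 p.2 ∧ M p.1 p.2 = true).card =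
            (univ.filter fun p : Fin N × Fin N => R p.1 p.2 ∧ M p.1 p.2 = false).card)
    (o : Fin N → ℕ)
    (ho : ∀ i : Fin N, o i = (univ.filter fun j => R i j ∧ M i j = true).card)
    (hS : ∀ i : Fin N, 3 * o i < N' ∨ 3 * o i > 2 * N')
    (L₁ L₀ : Finset (Fin N))
    (hL₁ : L₁ = univ.filter fun i => 3 * o i > 2 * N')
    (hL₀ : L₀ = univ.filter fun i => 3 * o i < N') :
    ∀ c : ℝ, 0 ≤ c → 12 * (N' : ℝ) * c < 4 * (N' : ℝ) - 3 * N →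
      ∃ j : Fin N,
        ((L₁.filter fun i => R i j ∧ M i j = true).card : ℝ) > c * N' ∧
        ((L₀.filter fun i => R i j ∧ M i j = false).card : ℝ) > c * N' := by
  intro c hc hcN
  set z : Fin N → ℕ := fun i => (univ.filter fun j => R i j ∧ M i j = false).card with hz
  have hoz : ∀ i, o i + z i = N' := fun i => by
    rw [ho, ← hrow i, ← card_filter_add_card_filter_not (s := univ.filter fun j => R i j)
      (fun j => M i j = true)]
    simp [hz, filter_filter]
  have hsum : ∑ i, o i = ∑ i, z i := by
    rw [card_filter_prod_eq_sum_s3 fun i j => R i j ∧ M i j = true,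
      card_filter_prod_eq_sum_s3 fun i j => R i j ∧ M i j = false] at hbal
    simpa only [ho] using hbal
  have htotal : ∑ i, o i + ∑ i, z i = Fintype.card (Fin N) * N' := by
    rw [← sum_add_distrib, sum_congr rfl fun i _ => hoz i]
    simp
  have hN₁ : N ≤ 4 * L₁.card := by
    simpa using card_le_four_mul_card_of_sum_eq hN'pos o L₁ (fun i => by have := hoz i; omega)
      (fun i hi => by
        have := hS i
        simp only [hL₁, mem_filter, mem_univ, true_and] at hi
        omega) (by omega)
  have hN₀ : N ≤ 4 * L₀.card := by
    simpa using card_le_four_mul_card_of_sum_eq hN'pos z L₀ (fun i => by have := hoz i; omega)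
      (fun i hi => by
        have := hS i
        have := hoz i
        simp only [hL₀, mem_filter, mem_univ, true_and] at hi
        omega) (by omega)
  by_contra! hcon
  set X : Finset (Fin N) :=
    univ.filter fun j => c * N' < ((L₁.filter fun i => R i j ∧ M i j = true).card : ℝ) with hX
  have hcN' : 0 ≤ c * N' := by positivity
  have h₁ := card_mul_sub_le_of_forall_le (fun i j => R i j ∧ M i j = true) L₁ X
    (k := 2 * N' / 3) (s := N / 4) hcN' (by positivity)
    (by have : (N : ℝ) ≤ 4 * L₁.card := by exact_mod_cast hN₁
        linarith)
    (fun i hi => by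
      simp only [hL₁, mem_filter, mem_univ, true_and] at hi
      rw [← ho]
      have : (2 * N' : ℝ) < 3 * o i := by exact_mod_cast hi
      linarith)
    (fun j hj => by simpa [hX] using hj)
  have h₀ := card_mul_sub_le_of_forall_le (fun i j => R i j ∧ M i j = false) L₀ Xᶜ
    (k := 2 * N' / 3) (s := N / 4) hcN' (by positivity)
    (by have : (N : ℝ) ≤ 4 * L₀.card := by exact_mod_cast hN₀
        linarith)
    (fun i hi => by
      simp only [hL₀, mem_filter, mem_univ, true_and] at hi
      have hlt : 2 * N' ≤ 3 * z i := by have := hoz i; omega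
      have : (2 * N' : ℝ) ≤ 3 * z i := by exact_mod_cast hlt
      change _ ≤ (z i : ℝ)
      linarith)
    (fun j hj => hcon j (by simpa [hX] using hj))
  have hXc : (X.card : ℝ) + Xᶜ.card = N := by
    exact_mod_cast (card_add_card_compl X).trans (Fintype.card_fin N)
  rw [compl_compl] at h₀
  have hNpos : (0 : ℝ) < N := by exact_mod_cast hN'pos.trans_le hN'
  have hle : (N : ℝ) / 4 * (4 * N' / 3 - N) ≤ N * (c * N') := by
    linear_combination h₁ + h₀ + (N / 4 + c * N') * hXc
  nlinarith [mul_pos hNpos (sub_pos.mpr hcN)]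
end

section
/- Let k ≤ N be natural numbers and let w : Equiv.Perm (Fin N) → ℝ be a k-wise independent probability distribution on permutations of Fin N. Let m be a natural number and for each s ∈ Fin m let ℓ(s) ≤ k and let v_s, u_s : Fin ℓ(s) → Fin N be injective functions; set A_s = {π : for all i, π(v_s i) = u_s i}, and assume the sets A_s are pairwise disjoint. Then the total w-probability of the union ⋃_s A_s equals |⋃_s A_s| / N!, i.e., its probability under the uniform distribution on permutations. -/
open Finset

/-- `w` is a probability distribution on permutations of `Fin N`. -/
def IsPermDist (N : ℕ) (w : Equiv.Perm (Fin N) → ℝ) : Prop :=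
  (∀ π, 0 ≤ w π) ∧ ∑ π : Equiv.Perm (Fin N), w π = 1

/-- `w` is a `k`-wise independent distribution on permutations of `Fin N`: every event given by
`k` agreement constraints `π (x i) = y i` (for injective `x`, `y`) has probability `(N−k)!/N!`. -/
def KWiseIndepPermDist (N k : ℕ) (w : Equiv.Perm (Fin N) → ℝ) : Prop :=
  ∀ x y : Fin k → Fin N, Function.Injective x → Function.Injective y →
    ∑ π ∈ univ.filter fun π : Equiv.Perm (Fin N) => ∀ i : Fin k, π (x i) = y i, w π =
      (Nat.factorial (N - k) : ℝ) / (Nat.factorial N : ℝ)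

theorem KWiseIndepPermDist.of_succ {N k : ℕ} {w : Equiv.Perm (Fin N) → ℝ} (hk : k + 1 ≤ N)
    (h : KWiseIndepPermDist N (k + 1) w) : KWiseIndepPermDist N k w := by
  classical
  intro x y hx hy
  obtain ⟨a, ha⟩ : ∃ a, a ∉ Set.range x := by
    by_contra! hsurj
    have := Fintype.card_le_of_surjective x hsurj
    simp only [Fintype.card_fin] at this
    omega
  have hfib : ∀ b : Fin N,
      ∑ π ∈ (univ.filter fun π : Equiv.Perm (Fin N) => ∀ i, π (x i) = y i) with π a = b, w π =
        if b ∈ univ.image y then 0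
        else (Nat.factorial (N - (k + 1)) : ℝ) / (Nat.factorial N : ℝ) := by
    intro b
    split_ifs with hb
    · obtain ⟨i, -, rfl⟩ := mem_image.mp hb
      refine sum_eq_zero fun π hπ => ?_
      simp only [mem_filter, mem_univ, true_and] at hπ
      exact absurd ⟨i, π.injective ((hπ.1 i).trans hπ.2.symm)⟩ ha
    · rw [← h (Fin.cons a x) (Fin.cons b y) (Fin.cons_injective_iff.mpr ⟨ha, hx⟩)
        (Fin.cons_injective_iff.mpr ⟨by simpa using hb, hy⟩)]
      refine sum_congr ?_ fun _ _ => rfl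
      ext π
      simp [Fin.forall_fin_succ, and_comm]
  have hcard : (univ.filter fun b => b ∉ univ.image y).card = N - k := by
    rw [filter_not, filter_mem_eq_inter, univ_inter, ← compl_eq_univ_sdiff, card_compl,
      card_image_of_injective _ hy, card_univ, Fintype.card_fin, Fintype.card_fin]
  rw [← sum_fiberwise _ (fun π : Equiv.Perm (Fin N) => π a), sum_congr rfl fun b _ => hfib b,
    sum_ite, sum_const_zero, zero_add, sum_const, hcard, nsmul_eq_mul, ← mul_div_assoc,
    ← Nat.cast_mul, show N - k = N - (k + 1) + 1 by omega, Nat.factorial_succ]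

theorem KWiseIndepPermDist.mono {N k l : ℕ} {w : Equiv.Perm (Fin N) → ℝ}
    (h : KWiseIndepPermDist N k w) (hk : k ≤ N) (hl : l ≤ k) : KWiseIndepPermDist N l w := by
  induction k, hl using Nat.le_induction with
  | base => exact h
  | succ n _ ih => exact ih (h.of_succ hk) (by omega)

/-- The uniform distribution on permutations of `Fin N` is `N`-wise independent. -/
theorem kWiseIndepPermDist_uniform (N : ℕ) :
    KWiseIndepPermDist N N fun _ => 1 / (Nat.factorial N : ℝ) := by
  intro x y hx hy
  let ex := Equiv.ofBijective x (Finite.injective_iff_bijective.mp hx)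
  let ey := Equiv.ofBijective y (Finite.injective_iff_bijective.mp hy)
  have hsingle : (univ.filter fun π : Equiv.Perm (Fin N) => ∀ i, π (x i) = y i) =
      {ex.symm.trans ey} := by
    ext π
    simp only [mem_filter, mem_univ, true_and, mem_singleton]
    constructor
    · intro h
      ext1 j
      obtain ⟨i, rfl⟩ := ex.surjective j
      simpa [ex, ey] using h i
    · rintro rfl i
      change ey (ex.symm (ex i)) = y i
      simp [ey]
  rw [hsingle, sum_singleton, Nat.sub_self, Nat.factorial_zero, Nat.cast_one]

/-- Abstract content of Lemma 6 (Section 6): on an event that is a disjoint union of classes,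
each given by at most `k` agreement constraints, a `k`-wise independent distribution on
permutations assigns the same probability as the uniform distribution. -/
theorem kWiseIndep_disjoint_union_prob (k N : ℕ) (hk : k ≤ N)
    (w : Equiv.Perm (Fin N) → ℝ) (hw : IsPermDist N w) (hind : KWiseIndepPermDist N k w)
    (m : ℕ) (ℓ : Fin m → ℕ) (hℓ : ∀ s, ℓ s ≤ k)
    (v u : (s : Fin m) → Fin (ℓ s) → Fin N)
    (hv : ∀ s, Function.Injective (v s)) (hu : ∀ s, Function.Injective (u s))
    (A : Fin m → Finset (Equiv.Perm (Fin N)))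
    (hA : ∀ s, A s = univ.filter fun π : Equiv.Perm (Fin N) => ∀ i : Fin (ℓ s), π (v s i) = u s i)
    (hdisj : ∀ s t : Fin m, s ≠ t → Disjoint (A s) (A t)) :
    ∑ π ∈ univ.biUnion A, w π =
      ((univ.biUnion A).card : ℝ) / (Nat.factorial N : ℝ) := by
  rw [card_eq_sum_ones, Nat.cast_sum, sum_div]
  have hpd : Set.PairwiseDisjoint (↑(univ : Finset (Fin m))) A := fun s _ t _ hst => hdisj s t hst
  rw [sum_biUnion hpd, sum_biUnion hpd]
  refine sum_congr rfl fun s _ => ?_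
  simp only [Nat.cast_one]
  rw [hA s, hind.mono hk (hℓ s) _ _ (hv s) (hu s),
    (kWiseIndepPermDist_uniform N).mono le_rfl ((hℓ s).trans hk) _ _ (hv s) (hu s)]
end
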